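/- arXiv:1304.4090 — 9 statements merged into one kernel-verified Lean document; each statement's English description precedes it below -/
import Mathlib

section
/- For every γ > 1 and every point (ρ, v, P) ∈ Ω_E, the first and third right eigenvector fields of the Eulerian Euler system satisfy ℓ₂(ρ,v,P) · [r₁, r₃](ρ,v,P) = 0, where [r₁, r₃] := (r₁·∇)r₃ − (r₃·∇)r₁ is the Lie bracket of the vector fields r₁ and r₃ on Ω_E (gradients taken in the variables (ρ, v, P)). -/
/- Eq. (3.29) of O. Glass, "On the controllability of the non-isentropic 1-D Euler
equation": `ℓ₂ · [r₁, r₃] = 0` for the Eulerian system. -/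

noncomputable section

/-- Points `(ρ, v, P)` of `ℝ³`. -/
abbrev V3 := Fin 3 → ℝ

/-- The physical domain `Ω_E = {ρ > 0, P > 0}`. -/
def OmegaE : Set V3 := {p | 0 < p 0 ∧ 0 < p 2}

/-- The sound speed `c = √(γP/ρ)`. -/
def soundSpeedE (γ : ℝ) (p : V3) : ℝ := Real.sqrt (γ * p 2 / p 0)

/-- First right eigenvector field `r₁ = (2/(γ+1))(−ρ/c, 1, −ρc)`. -/
def r1E (γ : ℝ) (p : V3) : V3 :=
  (2 / (γ + 1)) • ![-(p 0 / soundSpeedE γ p), 1, -(p 0 * soundSpeedE γ p)]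

/-- Third right eigenvector field `r₃ = (2/(γ+1))(ρ/c, 1, ρc)`. -/
def r3E (γ : ℝ) (p : V3) : V3 :=
  (2 / (γ + 1)) • ![p 0 / soundSpeedE γ p, 1, p 0 * soundSpeedE γ p]

/-- Second left eigenvector field `ℓ₂ = (1, 0, −1/c²)`. -/
def l2E (γ : ℝ) (p : V3) : V3 := ![1, 0, -(1 / (soundSpeedE γ p) ^ 2)]

/-- The Lie bracket `[X,Y] = (X·∇)Y − (Y·∇)X` of two vector fields on `ℝ³`. -/
def lieBracketVF (X Y : V3 → V3) (p : V3) : V3 :=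
  fderiv ℝ Y p (X p) - fderiv ℝ X p (Y p)

/-- Dot product on `ℝ³`. -/
def dot3 (a b : V3) : ℝ := a 0 * b 0 + a 1 * b 1 + a 2 * b 2

/-- The Fréchet derivative vanishes along a direction in which the function is invariant. -/
lemma fderiv_apply_eq_zero_of_forall_add_smul_eq {E F : Type*} [NormedAddCommGroup E]
    [NormedSpace ℝ E] [NormedAddCommGroup F] [NormedSpace ℝ F] {f : E → F} {x v : E}
    (h : ∀ t : ℝ, f (x + t • v) = f x) : fderiv ℝ f x v = 0 := by
  by_cases hf : DifferentiableAt ℝ f x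
  · rw [← hf.lineDeriv_eq_fderiv]
    simp [lineDeriv, h]
  · simp [fderiv_zero_of_not_differentiableAt hf]

/-- The fields `r₁` and `r₃` add up to a constant multiple of `∂_v`. -/
lemma r1E_add_r3E (γ : ℝ) (p : V3) :
    r1E γ p + r3E γ p = ![0, 2 * (2 / (γ + 1)), 0] := by
  ext i
  fin_cases i <;> simp [r1E, r3E, two_mul]

/-- The field `r₃` does not depend on the velocity. -/
lemma r3E_add_smul_velocity (γ a t : ℝ) (p : V3) :
    r3E γ (p + t • ![0, a, 0]) = r3E γ p := by
  simp [r3E, soundSpeedE]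

/-- The fields `r₁` and `r₃` commute. -/
lemma lieBracketVF_r1E_r3E (γ : ℝ) (p : V3) : lieBracketVF (r1E γ) (r3E γ) p = 0 := by
  have h : r1E γ = fun q => ![0, 2 * (2 / (γ + 1)), 0] - r3E γ q :=
    funext fun q => eq_sub_of_add_eq (r1E_add_r3E γ q)
  have hd : fderiv ℝ (r1E γ) p = -fderiv ℝ (r3E γ) p := by
    rw [h, fderiv_const_sub]
  rw [lieBracketVF, hd, neg_apply, sub_neg_eq_add, ← map_add, r1E_add_r3E]
  exact fderiv_apply_eq_zero_of_forall_add_smul_eq fun t => r3E_add_smul_velocity γ _ t p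

/-- **Eq. (3.29), Eulerian case:** `ℓ₂ · [r₁, r₃] = 0` at every point of `Ω_E`. -/
theorem eulerian_l2_dot_lieBracket_r1_r3 (γ : ℝ) (hγ : 1 < γ)
    (p : V3) (hp : p ∈ OmegaE) :
    dot3 (l2E γ p) (lieBracketVF (r1E γ) (r3E γ) p) = 0 := by
  simp [lieBracketVF_r1E_r3E, dot3]

end
end

section
/- For every γ > 1 and every point (τ, v, P) ∈ Ω_L, the first and third right eigenvector fields of the Lagrangian Euler system satisfy ℓ₂(τ,v,P) · [r₁, r₃](τ,v,P) = 0, where [r₁, r₃] := (r₁·∇)r₃ − (r₃·∇)r₁ is the Lie bracket of the vector fields r₁ and r₃ on Ω_L (gradients taken in the variables (τ, v, P)). -/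
/- Eq. (3.29) of O. Glass, "On the controllability of the non-isentropic 1-D Euler
equation": `ℓ₂ · [r₁, r₃] = 0` for the Lagrangian system. -/

noncomputable section

/-- The physical domain `Ω_L = {τ > 0, P > 0}`. -/
def OmegaL : Set V3 := {p | 0 < p 0 ∧ 0 < p 2}

/-- The quantity `c = √(γPτ)`. -/
def soundSpeedL (γ : ℝ) (p : V3) : ℝ := Real.sqrt (γ * p 2 * p 0)

/-- First right eigenvector field `r₁ = (2/(γ+1))(τ²/c, τ, −c)`. -/
def r1L (γ : ℝ) (p : V3) : V3 :=
  (2 / (γ + 1)) • ![(p 0) ^ 2 / soundSpeedL γ p, p 0, -soundSpeedL γ p]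

/-- Third right eigenvector field `r₃ = (2/(γ+1))(−τ²/c, τ, c)`. -/
def r3L (γ : ℝ) (p : V3) : V3 :=
  (2 / (γ + 1)) • ![-((p 0) ^ 2 / soundSpeedL γ p), p 0, soundSpeedL γ p]

/-- Second left eigenvector field `ℓ₂ = (1, 0, τ/(γP))`. -/
def l2L (γ : ℝ) (p : V3) : V3 := ![1, 0, p 0 / (γ * p 2)]

/-- A differentiable map that is constant along the line through `x` in direction `v` has
vanishing derivative at `x` in direction `v`. -/
lemma fderiv_apply_eq_zero_of_const_on_line {E F : Type*} [NormedAddCommGroup E]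
    [NormedSpace ℝ E] [NormedAddCommGroup F] [NormedSpace ℝ F] {f : E → F} {x v : E}
    (hf : DifferentiableAt ℝ f x) (h : ∀ t : ℝ, f (x + t • v) = f x) :
    fderiv ℝ f x v = 0 := by
  rw [← hf.lineDeriv_eq_fderiv]
  simp [lineDeriv, h]

lemma differentiableAt_soundSpeedL {γ : ℝ} (hγ : 0 < γ) {p : V3} (hp : p ∈ OmegaL) :
    DifferentiableAt ℝ (soundSpeedL γ) p := by
  obtain ⟨hτ, hP⟩ := hp
  have hne : γ * p 2 * p 0 ≠ 0 := by positivity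
  unfold soundSpeedL
  fun_prop (disch := assumption)

lemma soundSpeedL_pos {γ : ℝ} (hγ : 0 < γ) {p : V3} (hp : p ∈ OmegaL) :
    0 < soundSpeedL γ p :=
  Real.sqrt_pos.2 (mul_pos (mul_pos hγ hp.2) hp.1)

lemma differentiableAt_r1L {γ : ℝ} (hγ : 0 < γ) {p : V3} (hp : p ∈ OmegaL) :
    DifferentiableAt ℝ (r1L γ) p := by
  have hc := differentiableAt_soundSpeedL hγ hp
  have hne := (soundSpeedL_pos hγ hp).ne'
  refine differentiableAt_pi.2 fun i => ?_
  fin_cases i <;> simp [r1L] <;> fun_prop (disch := assumption)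

lemma differentiableAt_r3L {γ : ℝ} (hγ : 0 < γ) {p : V3} (hp : p ∈ OmegaL) :
    DifferentiableAt ℝ (r3L γ) p := by
  have hc := differentiableAt_soundSpeedL hγ hp
  have hne := (soundSpeedL_pos hγ hp).ne'
  refine differentiableAt_pi.2 fun i => ?_
  fin_cases i <;> simp [r3L] <;> fun_prop (disch := assumption)

lemma r3L_apply_eq_neg_r1L_apply (γ : ℝ) (p : V3) {i : Fin 3} (hi : i ≠ 1) :
    r3L γ p i = -r1L γ p i := by
  fin_cases i <;> simp_all [r1L, r3L]

/-- The field `r₁` does not depend on the velocity `v`. -/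
lemma r1L_congr (γ : ℝ) {p q : V3} (h0 : p 0 = q 0) (h2 : p 2 = q 2) :
    r1L γ p = r1L γ q := by
  simp [r1L, soundSpeedL, h0, h2]

/-- The bracket `[r₁, r₃]` is parallel to the `v`-axis. -/
lemma lieBracketVF_r1L_r3L_apply_eq_zero {γ : ℝ} (hγ : 0 < γ) {p : V3} (hp : p ∈ OmegaL)
    {i : Fin 3} (hi : i ≠ 1) : lieBracketVF (r1L γ) (r3L γ) p i = 0 := by
  have h1 := differentiableAt_r1L hγ hp
  have h3 := differentiableAt_r3L hγ hp
  have hneg : (fun q => r3L γ q i) = fun q => -r1L γ q i :=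
    funext fun q => r3L_apply_eq_neg_r1L_apply γ q hi
  have hcomp : ∀ u, fderiv ℝ (r3L γ) p u i = -fderiv ℝ (r1L γ) p u i := fun u => by
    have e1 := congrArg (· u) (fderiv_apply h1 i)
    have e3 := congrArg (· u) (fderiv_apply h3 i)
    rw [hneg, fderiv_fun_neg] at e3
    simp_all
  have hsum : fderiv ℝ (r1L γ) p (r1L γ p + r3L γ p) = 0 := by
    refine fderiv_apply_eq_zero_of_const_on_line h1 fun t => r1L_congr γ ?_ ?_
    · simp [r3L_apply_eq_neg_r1L_apply γ p (i := 0) (by decide)]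
    · simp [r3L_apply_eq_neg_r1L_apply γ p (i := 2) (by decide)]
  have hi_sum := congrFun hsum i
  rw [map_add, Pi.add_apply, Pi.zero_apply] at hi_sum
  rw [lieBracketVF, Pi.sub_apply, hcomp]
  linarith

/-- **Eq. (3.29), Lagrangian case:** `ℓ₂ · [r₁, r₃] = 0` at every point of `Ω_L`. -/
theorem lagrangian_l2_dot_lieBracket_r1_r3 (γ : ℝ) (hγ : 1 < γ)
    (p : V3) (hp : p ∈ OmegaL) :
    dot3 (l2L γ p) (lieBracketVF (r1L γ) (r3L γ) p) = 0 := by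
  have hγ0 : 0 < γ := one_pos.trans hγ
  simp [dot3, l2L, lieBracketVF_r1L_r3L_apply_eq_zero hγ0 hp (i := 0) (by decide),
    lieBracketVF_r1L_r3L_apply_eq_zero hγ0 hp (i := 2) (by decide)]

end
end

section
/- Let γ ∈ (1, 5/3) and β := (γ+1)/(γ−1). Define h(t) := (γ−1)t + 1 − γ√((1+βt)/(1+β)) for t > 0. Then h(1) = 0 and h(t) > 0 for every t ∈ (0,1). -/
/- The sign of the function `h` governing the reflection coefficient `α³` in the
interaction of a weak 1-wave with a strong 1-shock of the Lagrangian Euler system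
(proof of Lemma 3.3 of O. Glass, "On the controllability of the non-isentropic
1-D Euler equation"). -/

/-- For `γ ∈ (1, 5/3)` and `β = (γ+1)/(γ−1)`, the function
`h(t) = (γ−1)t + 1 − γ√((1+βt)/(1+β))` satisfies `h(1) = 0` and `h > 0` on
`(0,1)`. -/
theorem h_pos_on_unit_interval (γ β : ℝ) (hγ₁ : 1 < γ) (hγ₂ : γ < 5 / 3)
    (hβ : β = (γ + 1) / (γ - 1)) :
    ((γ - 1) * 1 + 1 - γ * Real.sqrt ((1 + β * 1) / (1 + β)) = 0) ∧
    ∀ t ∈ Set.Ioo (0:ℝ) 1, 0 < (γ - 1) * t + 1 - γ * Real.sqrt ((1 + β * t) / (1 + β)) := by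
  have hγ : 0 < γ := by linarith
  have hγ_sub : 0 < γ - 1 := by linarith
  have hβ_pos : 0 < 1 + β := by
    rw [hβ]
    positivity
  refine ⟨?_, fun t ⟨ht₀, ht₁⟩ => ?_⟩
  · rw [mul_one β, div_self hβ_pos.ne', Real.sqrt_one]
    ring
  · have hratio : (1 + β * t) / (1 + β) = (γ - 1 + (γ + 1) * t) / (2 * γ) := by
      rw [div_eq_div_iff hβ_pos.ne' (by positivity), hβ]
      field_simp
      ring
    have hlin : 0 < (γ - 1) * t + 1 := by positivity
    have hfactor : 0 < (2 - γ) * (γ + 1) / 2 - (γ - 1) ^ 2 * t := by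
      nlinarith [mul_pos hγ (sub_pos.2 hγ₂), mul_pos (pow_pos hγ_sub 2) (sub_pos.2 ht₁)]
    have hsqrt : √((1 + β * t) / (1 + β)) < ((γ - 1) * t + 1) / γ := by
      rw [hratio, Real.sqrt_lt' (by positivity), div_pow, div_lt_div_iff₀ (by positivity)
        (by positivity)]
      -- The difference of squares factors through its root `t = 1`.
      have hprod := mul_pos (mul_pos hγ (sub_pos.2 ht₁)) hfactor
      linear_combination 2 * hprod
    rw [lt_div_iff₀ hγ] at hsqrt
    linarith
end

section
/- Let γ ∈ (1, 5/3) and β := (γ+1)/(γ−1). Define h̃(x) := γ/(γ−1) − √((1+βx)/(1+β)) · (1/(γ−1) + 1/x) for x > 0. Then h̃(1) = 0 and h̃(x) < 0 for every x ∈ (1, ∞). -/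
/- The sign of the function `h̃` governing the coefficient `α³` in the interaction
of a weak 1-wave on the left of a strong 1-shock of the Lagrangian Euler system
(proof of Proposition 3.5 of O. Glass, "On the controllability of the
non-isentropic 1-D Euler equation"). -/

/-- The polynomial inequality obtained from `h̃(x) < 0` by clearing denominators and squaring. -/
lemma cubic_lt_of_one_lt {γ x : ℝ} (hγ₁ : 1 < γ) (hγ₂ : γ < 5 / 3) (hx : 1 < x) :
    2 * γ * (γ * x) ^ 2 < (γ - 1 + (γ + 1) * x) * (x + γ - 1) ^ 2 := by
  obtain ⟨t, rfl⟩ : ∃ t, x = 1 + t := ⟨x - 1, by ring⟩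
  have ht : 0 < t := by linarith
  have h₁ : 0 < 5 - 3 * γ := by linarith
  have h₂ : 0 < 2 - γ := by linarith
  have h : 0 < γ ^ 2 * (5 - 3 * γ) * t + 2 * γ * (2 - γ) * (γ + 1) * t ^ 2
      + (γ + 1) * t ^ 3 := by positivity
  linear_combination h

/-- For `γ ∈ (1, 5/3)` and `β = (γ+1)/(γ−1)`, the function
`h̃(x) = γ/(γ−1) − √((1+βx)/(1+β))·(1/(γ−1) + 1/x)` satisfies `h̃(1) = 0` and
`h̃ < 0` on `(1, ∞)`. -/
theorem htilde_neg_beyond_one (γ β : ℝ) (hγ₁ : 1 < γ) (hγ₂ : γ < 5 / 3)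
    (hβ : β = (γ + 1) / (γ - 1)) :
    (γ / (γ - 1) - Real.sqrt ((1 + β * 1) / (1 + β)) * (1 / (γ - 1) + 1 / 1) = 0) ∧
    ∀ x ∈ Set.Ioi (1:ℝ),
      γ / (γ - 1) - Real.sqrt ((1 + β * x) / (1 + β)) * (1 / (γ - 1) + 1 / x) < 0 := by
  have hg : 0 < γ - 1 := by linarith
  have hγ : 0 < γ := by linarith
  have hβ_pos : 0 < β := by rw [hβ]; positivity
  refine ⟨?_, fun x hx => ?_⟩
  · rw [mul_one, div_self (by positivity), Real.sqrt_one]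
    field_simp
    ring
  · have hx₁ : 1 < x := hx
    have hx₀ : 0 < x := by linarith
    have hs : 0 < x + γ - 1 := by linarith
    have hq : (1 + β * x) / (1 + β) = (γ - 1 + (γ + 1) * x) / (2 * γ) := by
      rw [div_eq_div_iff (by positivity) (by positivity), hβ]
      field_simp
      ring
    have hlt : γ * x / (x + γ - 1) < Real.sqrt ((1 + β * x) / (1 + β)) := by
      apply Real.lt_sqrt_of_sq_lt
      rw [hq, div_pow, div_lt_div_iff₀ (by positivity) (by positivity)]
      linarith [cubic_lt_of_one_lt hγ₁ hγ₂ hx₁]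
    have hc : 0 < 1 / (γ - 1) + 1 / x := by positivity
    have he : γ * x / (x + γ - 1) * (1 / (γ - 1) + 1 / x) = γ / (γ - 1) := by
      field_simp
      ring
    linarith [mul_lt_mul_of_pos_right hlt hc]
end

section
/- Let γ > 1 and β := (γ+1)/(γ−1). The function g(x) := x·((β+x)/(βx+1))^γ is strictly increasing on (0, ∞); in particular g(1) = 1 and g(x) > 1 for every x > 1. (Indeed (log g)'(x) = β(x−1)²/(x(β+x)(βx+1)) ≥ 0, vanishing only at x = 1.) -/
/- Strict monotonicity of the entropy-jump function `g` along the 1-shock curve of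
the Lagrangian Euler system (proof of Lemma 6.5 and Section 7 of O. Glass, "On
the controllability of the non-isentropic 1-D Euler equation"). -/

/-- The logarithmic derivative of `x ((β + x) / (β x + 1)) ^ γ` when `γ (β - 1) = β + 1`. -/
theorem hasDerivAt_log_add_mul_log_sub_log {γ β x : ℝ} (hβ : 0 < β) (h : γ * (β - 1) = β + 1)
    (hx : 0 < x) :
    HasDerivAt (fun x => Real.log x + γ * (Real.log (β + x) - Real.log (β * x + 1)))
      (β * (x - 1) ^ 2 / (x * (β + x) * (β * x + 1))) x := by
  have hadd : 0 < β + x := by positivity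
  have hmul : 0 < β * x + 1 := by positivity
  have hd := (Real.hasDerivAt_log hx.ne').add
    (((((hasDerivAt_id x).const_add β).log hadd.ne').sub
      ((((hasDerivAt_id x).const_mul β).add_const 1).log hmul.ne')).const_mul γ)
  refine hd.congr_deriv ?_
  simp only [id]
  field_simp
  linear_combination (-(β + 1) * x) * h

/-- A function on `(0, ∞)` whose derivative is positive except possibly at `c > 0` is strictly
increasing. -/
theorem strictMonoOn_Ioi_of_hasDerivAt_pos_of_ne {f f' : ℝ → ℝ} {c : ℝ} (hc : 0 < c)
    (hf : ∀ x, 0 < x → HasDerivAt f (f' x) x) (hf' : ∀ x, 0 < x → x ≠ c → 0 < f' x) :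
    StrictMonoOn f (Set.Ioi 0) := by
  have hcont : ContinuousOn f (Set.Ioi 0) := fun x hx =>
    (hf x hx).continuousAt.continuousWithinAt
  have hleft : StrictMonoOn f (Set.Ioc 0 c) := by
    refine strictMonoOn_of_deriv_pos (convex_Ioc 0 c) (hcont.mono fun x hx => hx.1) fun x hx => ?_
    rw [interior_Ioc] at hx
    rw [(hf x hx.1).deriv]
    exact hf' x hx.1 hx.2.ne
  have hright : StrictMonoOn f (Set.Ici c) := by
    refine strictMonoOn_of_deriv_pos (convex_Ici c)
      (hcont.mono fun x hx => hc.trans_le hx) fun x hx => ?_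
    rw [interior_Ici] at hx
    rw [(hf x (hc.trans hx)).deriv]
    exact hf' x (hc.trans hx) (ne_of_gt hx)
  rw [← Set.Ioc_union_Ici_eq_Ioi hc]
  exact hleft.union hright (isGreatest_Ioc hc) isLeast_Ici

/-- For `γ > 1` and `β = (γ+1)/(γ−1)`, the function `g(x) = x((β+x)/(βx+1))^γ` is
strictly increasing on `(0,∞)`; in particular `g(1) = 1` and `g(x) > 1` for every
`x > 1`. -/
theorem g_strictMonoOn (γ β : ℝ) (hγ : 1 < γ) (hβ : β = (γ + 1) / (γ - 1)) :
    StrictMonoOn (fun x : ℝ => x * ((β + x) / (β * x + 1)) ^ γ) (Set.Ioi 0) ∧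
    (1 * ((β + 1) / (β * 1 + 1)) ^ γ = 1) ∧
    ∀ x : ℝ, 1 < x → 1 < x * ((β + x) / (β * x + 1)) ^ γ := by
  have hγ' : 0 < γ - 1 := sub_pos.2 hγ
  have hβpos : 0 < β := by rw [hβ]; exact div_pos (by linarith) hγ'
  have hrel : γ * (β - 1) = β + 1 := by rw [hβ]; field_simp; ring
  have hlog : StrictMonoOn
      (fun x => Real.log x + γ * (Real.log (β + x) - Real.log (β * x + 1))) (Set.Ioi 0) := by
    refine strictMonoOn_Ioi_of_hasDerivAt_pos_of_ne one_pos
      (fun x hx => hasDerivAt_log_add_mul_log_sub_log hβpos hrel hx) fun x hx hne => ?_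
    have hsub : x - 1 ≠ 0 := sub_ne_zero.2 hne
    positivity
  have hexp : ∀ x ∈ Set.Ioi (0 : ℝ),
      Real.exp (Real.log x + γ * (Real.log (β + x) - Real.log (β * x + 1))) =
        x * ((β + x) / (β * x + 1)) ^ γ := by
    intro x hx
    have hx : 0 < x := hx
    have hadd : 0 < β + x := by positivity
    have hmul : 0 < β * x + 1 := by positivity
    rw [Real.exp_add, Real.exp_log hx, ← Real.log_div hadd.ne' hmul.ne',
      Real.rpow_def_of_pos (div_pos hadd hmul), mul_comm γ]
  have hmono : StrictMonoOn (fun x : ℝ => x * ((β + x) / (β * x + 1)) ^ γ) (Set.Ioi 0) :=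
    (Real.exp_strictMono.comp_strictMonoOn hlog).congr hexp
  have hone : 1 * ((β + 1) / (β * 1 + 1)) ^ γ = 1 := by
    rw [mul_one, div_self (by positivity), Real.one_rpow, one_mul]
  refine ⟨hmono, hone, fun x hx => ?_⟩
  exact hone.symm.trans_lt (hmono (Set.mem_Ioi.2 one_pos) (Set.mem_Ioi.2 (one_pos.trans hx)) hx)
end

section
/- Let γ > 1 and let u₋ = (τ₋, v₋, P₋) and u₊ = (τ₊, v₊, P₊) be any two states in Ω_L. With c_± := √(γ P_± τ_±), [v] := v₊ − v₋, [P] := P₊ − P₋, and [f] := (−[v], [P], P₊v₊ − P₋v₋), the determinant of the 3×3 matrix with columns R̃₁(u₋), R̃₃(u₊), [f] equals −[v]²·c₋c₊/(τ₋τ₊) − [P]². In particular this determinant is ≤ 0, and it is strictly negative unless v₊ = v₋ and P₊ = P₋. -/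
/- A determinant computation from the proof of Proposition 3.5 of O. Glass, "On
the controllability of the non-isentropic 1-D Euler equation":
`det(R̃₁(u₋), R̃₃(u₊), [f]) = −[v]²c₋c₊/(τ₋τ₊) − [P]²`. -/

open Matrix

/-- For any two Lagrangian states `u₋ = (τ₋,v₋,P₋)` and `u₊ = (τ₊,v₊,P₊)` in
`Ω_L`, the determinant of the matrix with columns
`R̃₁(u₋) = (1, c₋/τ₋, −P₋ + c₋v₋/τ₋)`, `R̃₃(u₊) = (−1, c₊/τ₊, P₊ + c₊v₊/τ₊)` and
`[f] = (−[v], [P], P₊v₊ − P₋v₋)` equals `−[v]²c₋c₊/(τ₋τ₊) − [P]²`; in particular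
it is `≤ 0`, and `< 0` unless `v₊ = v₋` and `P₊ = P₋`. -/
theorem det_R1m_R3p_fluxJump (γ : ℝ) (hγ : 1 < γ)
    (τm vm Pm τp vp Pp cm cp : ℝ)
    (hτm : 0 < τm) (hPm : 0 < Pm) (hτp : 0 < τp) (hPp : 0 < Pp)
    (hcm : cm = Real.sqrt (γ * Pm * τm)) (hcp : cp = Real.sqrt (γ * Pp * τp)) :
    (!![(1 : ℝ),            -1,                 -(vp - vm);
        cm / τm,            cp / τp,            Pp - Pm;
        -Pm + cm * vm / τm, Pp + cp * vp / τp,  Pp * vp - Pm * vm]).det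
      = -((vp - vm) ^ 2 * (cm * cp) / (τm * τp)) - (Pp - Pm) ^ 2 ∧
    (!![(1 : ℝ),            -1,                 -(vp - vm);
        cm / τm,            cp / τp,            Pp - Pm;
        -Pm + cm * vm / τm, Pp + cp * vp / τp,  Pp * vp - Pm * vm]).det ≤ 0 ∧
    ((vp ≠ vm ∨ Pp ≠ Pm) →
      (!![(1 : ℝ),            -1,                 -(vp - vm);
          cm / τm,            cp / τp,            Pp - Pm;
          -Pm + cm * vm / τm, Pp + cp * vp / τp,  Pp * vp - Pm * vm]).det < 0) := by
  have hγ0 : 0 < γ := zero_lt_one.trans hγ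
  have hcm0 : 0 < cm := hcm ▸ Real.sqrt_pos.2 (by positivity)
  have hcp0 : 0 < cp := hcp ▸ Real.sqrt_pos.2 (by positivity)
  have hdet : (!![(1 : ℝ),            -1,                 -(vp - vm);
        cm / τm,            cp / τp,            Pp - Pm;
        -Pm + cm * vm / τm, Pp + cp * vp / τp,  Pp * vp - Pm * vm]).det
      = -((vp - vm) ^ 2 * (cm * cp) / (τm * τp)) - (Pp - Pm) ^ 2 := by
    simp only [det_fin_three, of_apply, cons_val]
    field_simp
    ring
  have hv : 0 ≤ (vp - vm) ^ 2 * (cm * cp) / (τm * τp) := by positivity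
  have hP : 0 ≤ (Pp - Pm) ^ 2 := sq_nonneg _
  refine ⟨hdet, by rw [hdet]; linarith, fun h => ?_⟩
  rw [hdet]
  rcases h with h | h
  · have hsub : vp - vm ≠ 0 := sub_ne_zero.2 h
    have : 0 < (vp - vm) ^ 2 * (cm * cp) / (τm * τp) := by positivity
    linarith
  · have hsub : Pp - Pm ≠ 0 := sub_ne_zero.2 h
    have : 0 < (Pp - Pm) ^ 2 := by positivity
    linarith
end

section
/- Let γ > 1 and let u₋ = (τ₋, v₋, P₋) and u₊ = (τ₊, v₊, P₊) be any two states in Ω_L. With c₊ := √(γP₊τ₊), [v] := v₊ − v₋, [P] := P₊ − P₋, R₂(u₊) := (1, 0, P₊/(γ−1)) and [f] := (−[v], [P], P₊v₊ − P₋v₋), the determinant of the 3×3 matrix with columns R₂(u₊), R̃₃(u₊), [f] equals (c₊/τ₊)·(P₋ + P₊/(γ−1))·[v] − (γP₊/(γ−1))·[P]. In particular, if [v] < 0 and [P] > 0 (as across a 1-shock), this determinant is strictly negative. -/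
/- A determinant computation from the proof of Proposition 3.5 of O. Glass, "On
the controllability of the non-isentropic 1-D Euler equation":
`det(R₂(u₊), R̃₃(u₊), [f]) = (c₊/τ₊)(P₋ + P₊/(γ−1))[v] − (γP₊/(γ−1))[P]`. -/

open Matrix

/-- For any two Lagrangian states `u₋ = (τ₋,v₋,P₋)` and `u₊ = (τ₊,v₊,P₊)` in
`Ω_L`, the determinant of the matrix with columns `R₂(u₊) = (1, 0, P₊/(γ−1))`,
`R̃₃(u₊) = (−1, c₊/τ₊, P₊ + c₊v₊/τ₊)` and `[f] = (−[v], [P], P₊v₊ − P₋v₋)` equals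
`(c₊/τ₊)(P₋ + P₊/(γ−1))[v] − (γP₊/(γ−1))[P]`; in particular it is `< 0` whenever
`[v] < 0` and `[P] > 0` (as across a 1-shock). -/
theorem det_R2p_R3p_fluxJump (γ : ℝ) (hγ : 1 < γ)
    (τm vm Pm τp vp Pp cp : ℝ)
    (hτm : 0 < τm) (hPm : 0 < Pm) (hτp : 0 < τp) (hPp : 0 < Pp)
    (hcp : cp = Real.sqrt (γ * Pp * τp)) :
    (!![(1 : ℝ),      -1,                -(vp - vm);
        0,            cp / τp,           Pp - Pm;
        Pp / (γ - 1), Pp + cp * vp / τp, Pp * vp - Pm * vm]).det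
      = (cp / τp) * (Pm + Pp / (γ - 1)) * (vp - vm) - (γ * Pp / (γ - 1)) * (Pp - Pm) ∧
    (vp - vm < 0 → 0 < Pp - Pm →
      (!![(1 : ℝ),      -1,                -(vp - vm);
          0,            cp / τp,           Pp - Pm;
          Pp / (γ - 1), Pp + cp * vp / τp, Pp * vp - Pm * vm]).det < 0) := by
  have hγ1 : 0 < γ - 1 := sub_pos.mpr hγ
  refine (and_iff_left_of_imp fun h hv hP => ?_).mpr ?_
  rotate_left
  · have hγ' : γ - 1 ≠ 0 := hγ1.ne'
    rw [Matrix.det_fin_three]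
    simp only [Matrix.of_apply, Matrix.cons_val]
    field_simp
    ring
  · have hγ0 : 0 < γ := one_pos.trans hγ
    have hc : 0 < cp := hcp ▸ Real.sqrt_pos.mpr (by positivity)
    have hvel : cp / τp * (Pm + Pp / (γ - 1)) * (vp - vm) < 0 :=
      mul_neg_of_pos_of_neg (by positivity) hv
    have hpres : 0 < γ * Pp / (γ - 1) * (Pp - Pm) := mul_pos (by positivity) hP
    rw [h]
    linarith
end

section
/- Let γ > 1, P > 0, ρ₋ > 0, ρ₊ > 0 and v₋, v₊ ∈ ℝ, and set u₋ = (ρ₋, v₋, P) and u₊ = (ρ₊, v₊, P) (two states with equal pressure, as on the two sides of a 2-contact discontinuity of the Eulerian Euler system). With c_± := √(γP/ρ_±), one has ℓ₃(u₋)·r₃(u₊) = (ρ₋c₋ + ρ₊c₊)/(2ρ₋c₋) > 0, and the interaction coefficients satisfy −(ℓ₁(u₋)·r₃(u₊))/(ℓ₃(u₋)·r₃(u₊)) = (√ρ₊ − √ρ₋)/(√ρ₊ + √ρ₋) and 1/(ℓ₃(u₋)·r₃(u₊)) = 2√ρ₋/(√ρ₊ + √ρ₋). -/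
/- The interaction coefficients of a weak 3-wave with a strong 2-contact
discontinuity of the Eulerian Euler system (Proposition 3.1 of O. Glass, "On the
controllability of the non-isentropic 1-D Euler equation"). -/

noncomputable section

/-- First left eigenvector field `ℓ₁ = ((γ+1)/2)(0, 1/2, −1/(2ρc))`. -/
def l1E (γ : ℝ) (p : V3) : V3 :=
  ((γ + 1) / 2) • ![0, 1 / 2, -(1 / (2 * p 0 * soundSpeedE γ p))]

/-- Third left eigenvector field `ℓ₃ = ((γ+1)/2)(0, 1/2, 1/(2ρc))`. -/
def l3E (γ : ℝ) (p : V3) : V3 :=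
  ((γ + 1) / 2) • ![0, 1 / 2, 1 / (2 * p 0 * soundSpeedE γ p)]

theorem mul_soundSpeed_eq {γ P ρ : ℝ} (hγP : 0 ≤ γ * P) (hρ : 0 < ρ) :
    ρ * Real.sqrt (γ * P / ρ) = Real.sqrt (γ * P) * Real.sqrt ρ := by
  have hs : Real.sqrt ρ ≠ 0 := (Real.sqrt_pos.2 hρ).ne'
  rw [Real.sqrt_div hγP, mul_div_assoc', div_eq_iff hs, mul_assoc, Real.mul_self_sqrt hρ.le,
    mul_comm]

theorem dot3_l3E_r3E {γ : ℝ} (hγ : γ + 1 ≠ 0) {p q : V3} (hp : p 0 * soundSpeedE γ p ≠ 0) :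
    dot3 (l3E γ p) (r3E γ q)
      = (p 0 * soundSpeedE γ p + q 0 * soundSpeedE γ q) / (2 * p 0 * soundSpeedE γ p) := by
  obtain ⟨h0, hc⟩ := mul_ne_zero_iff.1 hp
  simp only [dot3, l3E, r3E, Pi.smul_apply, smul_eq_mul, Matrix.cons_val]
  field_simp
  ring

theorem dot3_l1E_r3E {γ : ℝ} (hγ : γ + 1 ≠ 0) {p q : V3} (hp : p 0 * soundSpeedE γ p ≠ 0) :
    dot3 (l1E γ p) (r3E γ q)
      = (p 0 * soundSpeedE γ p - q 0 * soundSpeedE γ q) / (2 * p 0 * soundSpeedE γ p) := by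
  obtain ⟨h0, hc⟩ := mul_ne_zero_iff.1 hp
  simp only [dot3, l1E, r3E, Pi.smul_apply, smul_eq_mul, Matrix.cons_val]
  field_simp
  ring

/-- **Proposition 3.1 (coefficients).** For two Eulerian states
`u₋ = (ρ₋, v₋, P)` and `u₊ = (ρ₊, v₊, P)` with the same pressure (as across a
2-contact discontinuity), with `c_± = √(γP/ρ_±)` one has
`ℓ₃(u₋)·r₃(u₊) = (ρ₋c₋ + ρ₊c₊)/(2ρ₋c₋) > 0`,
`−(ℓ₁(u₋)·r₃(u₊))/(ℓ₃(u₋)·r₃(u₊)) = (√ρ₊ − √ρ₋)/(√ρ₊ + √ρ₋)` and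
`1/(ℓ₃(u₋)·r₃(u₊)) = 2√ρ₋/(√ρ₊ + √ρ₋)`. -/
theorem eulerian_contact_interaction_coefficients (γ : ℝ) (hγ : 1 < γ)
    (P ρm ρp vm vp cm cp : ℝ) (hP : 0 < P) (hρm : 0 < ρm) (hρp : 0 < ρp)
    (hcm : cm = Real.sqrt (γ * P / ρm)) (hcp : cp = Real.sqrt (γ * P / ρp)) :
    dot3 (l3E γ ![ρm, vm, P]) (r3E γ ![ρp, vp, P])
        = (ρm * cm + ρp * cp) / (2 * ρm * cm) ∧
    0 < dot3 (l3E γ ![ρm, vm, P]) (r3E γ ![ρp, vp, P]) ∧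
    -(dot3 (l1E γ ![ρm, vm, P]) (r3E γ ![ρp, vp, P]))
        / dot3 (l3E γ ![ρm, vm, P]) (r3E γ ![ρp, vp, P])
      = (Real.sqrt ρp - Real.sqrt ρm) / (Real.sqrt ρp + Real.sqrt ρm) ∧
    1 / dot3 (l3E γ ![ρm, vm, P]) (r3E γ ![ρp, vp, P])
      = 2 * Real.sqrt ρm / (Real.sqrt ρp + Real.sqrt ρm) := by
  have hγ1 : γ + 1 ≠ 0 := by linarith
  have hγP : 0 < γ * P := by positivity
  have hcm' : soundSpeedE γ ![ρm, vm, P] = cm := hcm.symm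
  have hcp' : soundSpeedE γ ![ρp, vp, P] = cp := hcp.symm
  have hm : ρm * cm = Real.sqrt (γ * P) * Real.sqrt ρm := hcm ▸ mul_soundSpeed_eq hγP.le hρm
  have hp : ρp * cp = Real.sqrt (γ * P) * Real.sqrt ρp := hcp ▸ mul_soundSpeed_eq hγP.le hρp
  have hk : 0 < Real.sqrt (γ * P) := Real.sqrt_pos.2 hγP
  have hsm : 0 < Real.sqrt ρm := Real.sqrt_pos.2 hρm
  have hsp : 0 < Real.sqrt ρp := Real.sqrt_pos.2 hρp
  have hne : (![ρm, vm, P] : V3) 0 * soundSpeedE γ ![ρm, vm, P] ≠ 0 := by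
    rw [hcm', Matrix.cons_val_zero, hm]
    positivity
  rw [dot3_l3E_r3E hγ1 hne, dot3_l1E_r3E hγ1 hne, hcm', hcp']
  simp only [Matrix.cons_val_zero, mul_assoc, hm, hp]
  refine ⟨trivial, by positivity, ?_, ?_⟩
  · field_simp
    ring
  · field_simp
    ring

end
end

section
/- Let n ≥ 1, let O ⊆ ℝⁿ be open, let f ∈ C¹(O; ℝⁿ), and let (η, q) be an entropy/entropy-flux pair for f. Let I ⊆ ℝ be an interval, U₋ ∈ O, and let U₊ : I → O and s : I → ℝ be differentiable maps satisfying the Rankine–Hugoniot relation f(U₊(σ)) − f(U₋) = s(σ)·(U₊(σ) − U₋) for all σ ∈ I. Then for every σ ∈ I, d/dσ [ s(σ)(η(U₊(σ)) − η(U₋)) − (q(U₊(σ)) − q(U₋)) ] = s'(σ) · ( η(U₊(σ)) − η(U₋) − Dη(U₊(σ))·(U₊(σ) − U₋) ). In particular, if s is constant on I and U₊(σ₀) = U₋ for some σ₀ ∈ I, then s·(η(U₊(σ)) − η(U₋)) = q(U₊(σ)) − q(U₋) for every σ ∈ I. -/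
/- Eq. (6.12) of O. Glass, "On the controllability of the non-isentropic 1-D Euler
equation": evolution of the entropy production along a Hugoniot-type curve, and
its consequence for discontinuities travelling at constant speed. -/

/-- Derivative of the entropy production along a curve satisfying the Rankine–Hugoniot relation,
at a single point of an arbitrary parameter set. -/
theorem hasDerivWithinAt_entropyProduction {E : Type*} [NormedAddCommGroup E] [NormedSpace ℝ E]
    {f : E → E} {η q : E → ℝ} {I : Set ℝ} {Um : E} {Up : ℝ → E} {Up' : E} {s : ℝ → ℝ} {s' σ : ℝ}
    (hf : DifferentiableAt ℝ f (Up σ)) (hη : DifferentiableAt ℝ η (Up σ))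
    (hq : DifferentiableAt ℝ q (Up σ))
    (hpair : (fderiv ℝ η (Up σ)).comp (fderiv ℝ f (Up σ)) = fderiv ℝ q (Up σ))
    (hσ : σ ∈ I) (hUp : HasDerivWithinAt Up Up' I σ) (hs : HasDerivWithinAt s s' I σ)
    (hRH : ∀ τ ∈ I, f (Up τ) - f Um = s τ • (Up τ - Um)) :
    HasDerivWithinAt (fun τ => s τ * (η (Up τ) - η Um) - (q (Up τ) - q Um))
      (s' * (η (Up σ) - η Um - fderiv ℝ η (Up σ) (Up σ - Um))) I σ := by
  by_cases hacc : AccPt σ (Filter.principal I)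
  · have hfU : HasDerivWithinAt (fun τ => f (Up τ) - f Um) (fderiv ℝ f (Up σ) Up') I σ :=
      (hf.hasFDerivAt.comp_hasDerivWithinAt σ hUp).sub_const _
    have hsU : HasDerivWithinAt (fun τ => f (Up τ) - f Um) (s σ • Up' + s' • (Up σ - Um)) I σ :=
      (hs.smul (hUp.sub_const Um)).congr hRH (hRH σ hσ)
    have hRH' : fderiv ℝ f (Up σ) Up' = s σ • Up' + s' • (Up σ - Um) :=
      (uniqueDiffWithinAt_iff_accPt.mpr hacc).eq_deriv I hfU hsU
    have hηU : HasDerivWithinAt (fun τ => η (Up τ) - η Um) (fderiv ℝ η (Up σ) Up') I σ :=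
      (hη.hasFDerivAt.comp_hasDerivWithinAt σ hUp).sub_const _
    have hqU : HasDerivWithinAt (fun τ => q (Up τ) - q Um) (fderiv ℝ q (Up σ) Up') I σ :=
      (hq.hasFDerivAt.comp_hasDerivWithinAt σ hUp).sub_const _
    refine ((hs.mul hηU).sub hqU).congr_deriv ?_
    rw [← hpair, ContinuousLinearMap.comp_apply, hRH', map_add, map_smul, map_smul,
      smul_eq_mul, smul_eq_mul]
    ring
  · exact HasFDerivWithinAt.of_not_accPt hacc

/-- Let `O ⊆ ℝⁿ` be open, `f ∈ C¹(O; ℝⁿ)`, and let `(η, q)` be an entropy/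
entropy-flux pair for `f` (i.e. `Dη(U)·Df(U) = Dq(U)` on `O`, with `η, q` of
class `C¹` on `O`). Let `I` be an interval, `U₋ ∈ O`, and let `U₊ : I → O`,
`s : I → ℝ` be differentiable (with derivatives `U₊'`, `s'`) and satisfy the
Rankine–Hugoniot relation `f(U₊(σ)) − f(U₋) = s(σ)·(U₊(σ) − U₋)` on `I`. Then
`d/dσ [s(σ)(η(U₊(σ)) − η(U₋)) − (q(U₊(σ)) − q(U₋))]
  = s'(σ)(η(U₊(σ)) − η(U₋) − Dη(U₊(σ))·(U₊(σ) − U₋))` on `I`; in particular, if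
`s` is constant on `I` and `U₊(σ₀) = U₋` for some `σ₀ ∈ I`, then
`s·(η(U₊(σ)) − η(U₋)) = q(U₊(σ)) − q(U₋)` for every `σ ∈ I`. -/
theorem entropy_production_along_hugoniot
    (n : ℕ) (hn : 1 ≤ n)
    (O : Set (Fin n → ℝ)) (hO : IsOpen O)
    (f : (Fin n → ℝ) → (Fin n → ℝ)) (hf : ContDiffOn ℝ 1 f O)
    (η q : (Fin n → ℝ) → ℝ)
    (hη : ContDiffOn ℝ 1 η O) (hq : ContDiffOn ℝ 1 q O)
    (hpair : ∀ U ∈ O, (fderiv ℝ η U).comp (fderiv ℝ f U) = fderiv ℝ q U)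
    (I : Set ℝ) (hI : Convex ℝ I)
    (Um : Fin n → ℝ) (hUm : Um ∈ O)
    (Up : ℝ → Fin n → ℝ) (Up' : ℝ → Fin n → ℝ) (s s' : ℝ → ℝ)
    (hUpO : ∀ σ ∈ I, Up σ ∈ O)
    (hUpd : ∀ σ ∈ I, HasDerivWithinAt Up (Up' σ) I σ)
    (hsd : ∀ σ ∈ I, HasDerivWithinAt s (s' σ) I σ)
    (hRH : ∀ σ ∈ I, f (Up σ) - f Um = s σ • (Up σ - Um)) :
    (∀ σ ∈ I, HasDerivWithinAt
        (fun τ => s τ * (η (Up τ) - η Um) - (q (Up τ) - q Um))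
        (s' σ * (η (Up σ) - η Um - fderiv ℝ η (Up σ) (Up σ - Um))) I σ) ∧
    ((∀ σ ∈ I, ∀ σ' ∈ I, s σ = s σ') →
      ∀ σ₀ ∈ I, Up σ₀ = Um →
        ∀ σ ∈ I, s σ * (η (Up σ) - η Um) = q (Up σ) - q Um) := by
  have hprod : ∀ (r : ℝ) (σ : ℝ), σ ∈ I → HasDerivWithinAt s r I σ → HasDerivWithinAt
      (fun τ => s τ * (η (Up τ) - η Um) - (q (Up τ) - q Um))
      (r * (η (Up σ) - η Um - fderiv ℝ η (Up σ) (Up σ - Um))) I σ := by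
    intro r σ hσ hr
    have hmem := hO.mem_nhds (hUpO σ hσ)
    exact hasDerivWithinAt_entropyProduction
      ((hf.contDiffAt hmem).differentiableAt one_ne_zero)
      ((hη.contDiffAt hmem).differentiableAt one_ne_zero)
      ((hq.contDiffAt hmem).differentiableAt one_ne_zero)
      (hpair _ (hUpO σ hσ)) hσ (hUpd σ hσ) hr hRH
  refine ⟨fun σ hσ => hprod _ σ hσ (hsd σ hσ), fun hconst σ₀ hσ₀ hU₀ σ hσ => ?_⟩
  have hbound := hI.norm_image_sub_le_of_norm_hasDerivWithin_le (C := 0)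
    (fun τ hτ => hprod 0 τ hτ <| (hasDerivWithinAt_const τ I (s τ)).congr
      (fun τ' hτ' => hconst τ' hτ' τ hτ) rfl)
    (fun τ _ => by simp) hσ₀ hσ
  simpa [hU₀, sub_eq_zero] using hbound
end
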